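/- Let Γ ⊂ P^n be a finite subscheme over an algebraically closed field of characteristic 0 and V ⊂ P^n a hypersurface of degree k such that reg(Γ) > reg(Γ ∩ V). Then reg(Γ : V) ≥ reg(Γ) − k. -/

import Mathlib

open MvPolynomial Filter
open scoped Classical

attribute [local instance] MvPolynomial.gradedAlgebra

noncomputable section

variable {K : Type} [Field K] {n : ℕ}

/-- The Hilbert function, in degree `m`, of the quotient of the homogeneous
coordinate ring of `ℙ^n_K` by the ideal `I`. -/
def hilbF (I : Ideal (MvPolynomial (Fin (n+1)) K)) (m : ℕ) : ℕ :=
  Module.finrank K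
    ((MvPolynomial.homogeneousSubmodule (Fin (n+1)) K m).map
      (Ideal.Quotient.mkₐ K I).toLinearMap)

/-- The irrelevant maximal ideal `(x_0, …, x_n)`. -/
def irrelevantIdeal (K : Type) [Field K] (n : ℕ) : Ideal (MvPolynomial (Fin (n+1)) K) :=
  Ideal.span (Set.range MvPolynomial.X)

/-- Saturation of a homogeneous ideal with respect to the irrelevant ideal. -/
def saturate (I : Ideal (MvPolynomial (Fin (n+1)) K)) : Ideal (MvPolynomial (Fin (n+1)) K) :=
  ⨆ k : ℕ, Submodule.colon I ((irrelevantIdeal K n ^ k : Ideal (MvPolynomial (Fin (n+1)) K)) : Submodule (MvPolynomial (Fin (n+1)) K) (MvPolynomial (Fin (n+1)) K))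

/-- `I` is the (saturated, homogeneous) ideal of a nonempty finite closed subscheme of
`ℙ^n`, i.e. its Hilbert function is eventually a positive constant. -/
structure IsFiniteSubscheme (I : Ideal (MvPolynomial (Fin (n+1)) K)) : Prop where
  homog : Ideal.IsHomogeneous (MvPolynomial.homogeneousSubmodule (Fin (n+1)) K) I
  saturated : saturate I = I
  finite : ∃ d : ℕ, 0 < d ∧ ∀ᶠ m : ℕ in atTop, hilbF I m = d

/-- The degree (length) of the finite scheme with ideal `I` : the eventual value of
its Hilbert function. -/
def schemeDeg (I : Ideal (MvPolynomial (Fin (n+1)) K)) : ℕ :=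
  if h : ∃ d : ℕ, ∀ᶠ m : ℕ in atTop, hilbF I m = d then h.choose else 0

/-- The Castelnuovo–Mumford regularity of the finite scheme with ideal `I` : the least
`p ≥ 1` such that the scheme is `(p-1)`-normal (for a finite scheme, `p`-regularity is
equivalent to `(p-1)`-normality). -/
def schemeReg (I : Ideal (MvPolynomial (Fin (n+1)) K)) : ℕ :=
  sInf {p : ℕ | 1 ≤ p ∧ ∀ m : ℕ, p - 1 ≤ m → hilbF I m = schemeDeg I}

/-- `h¹(ℙ^n, I_Γ(q))` for a finite scheme `Γ` and `q ≥ 0`: the failure of `q`-normality,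
`deg Γ - h_Γ(q)`. -/
def h1F (I : Ideal (MvPolynomial (Fin (n+1)) K)) (q : ℕ) : ℕ :=
  schemeDeg I - hilbF I q

/-- `J` is the ideal of a `t`-dimensional linear subspace of `ℙ^n`: it is generated by a
space of linear forms of codimension... i.e. of `K`-dimension `n - t`. -/
def IsLinearSubspace (J : Ideal (MvPolynomial (Fin (n+1)) K)) (t : ℕ) : Prop :=
  ∃ W : Submodule K (MvPolynomial (Fin (n+1)) K),
    W ≤ MvPolynomial.homogeneousSubmodule (Fin (n+1)) K 1 ∧
    Module.finrank K W + t = n ∧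
    J = Ideal.span (W : Set (MvPolynomial (Fin (n+1)) K))

/-- The ideal of the scheme-theoretic intersection (defined by the sum of the ideal
sheaves): the saturation of `I + J`. -/
def interIdeal (I J : Ideal (MvPolynomial (Fin (n+1)) K)) : Ideal (MvPolynomial (Fin (n+1)) K) :=
  saturate (I ⊔ J)

/-- The residual scheme `Γ : V`, where `V` is the hypersurface `{f = 0}`, is defined by
the colon ideal `(I_Γ : f)`. -/
def residualIdeal (I : Ideal (MvPolynomial (Fin (n+1)) K)) (f : MvPolynomial (Fin (n+1)) K) :
    Ideal (MvPolynomial (Fin (n+1)) K) :=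
  Submodule.colon I (Ideal.span {f})

/-- `Γ` admits a `(t+2)`-secant `t`-plane. -/
def HasSecantPlane (I : Ideal (MvPolynomial (Fin (n+1)) K)) (t : ℕ) : Prop :=
  ∃ J : Ideal (MvPolynomial (Fin (n+1)) K),
    IsLinearSubspace J t ∧ t + 2 ≤ schemeDeg (interIdeal I J)

/-- `t(Γ)`: the smallest `t` such that `Γ` admits a `(t+2)`-secant `t`-plane. -/
def tInv (I : Ideal (MvPolynomial (Fin (n+1)) K)) : ℕ :=
  sInf {t : ℕ | HasSecantPlane I t}

/-- `Γ` is in linearly general position if `t(Γ) = n`. -/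
def InLinGenPos (I : Ideal (MvPolynomial (Fin (n+1)) K)) : Prop :=
  tInv I = n

/-- `Γ ⊆ ℙ^n` is nondegenerate: `I(Γ)` contains no nonzero linear form. -/
def NondegenerateScheme (I : Ideal (MvPolynomial (Fin (n+1)) K)) : Prop :=
  Submodule.restrictScalars K I ⊓ MvPolynomial.homogeneousSubmodule (Fin (n+1)) K 1 = ⊥

/-- The (projective) dimension of the linear span `⟨Γ⟩` of the scheme with ideal `I`:
`n` minus the number of independent linear forms in `I`. -/
def spanDim (I : Ideal (MvPolynomial (Fin (n+1)) K)) : ℕ :=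
  n - Module.finrank K
    ↥(Submodule.restrictScalars K I ⊓ MvPolynomial.homogeneousSubmodule (Fin (n+1)) K 1)

/-- `Γ ∩ Λ` is nondegenerate as a subscheme of the `t`-plane `Λ`: it is contained in no
`(t-1)`-dimensional linear subspace of `Λ`. -/
def NondegenerateIn (I Λ : Ideal (MvPolynomial (Fin (n+1)) K)) (t : ℕ) : Prop :=
  ∀ J : Ideal (MvPolynomial (Fin (n+1)) K),
    IsLinearSubspace J (t - 1) → Λ ≤ J → ¬ J ≤ interIdeal I Λ

/-- `Γ ∩ Λ` is in linearly general position as a subscheme of the `t`-plane `Λ`: it has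
no `(s+2)`-secant `s`-plane inside `Λ` for any `s < t`. -/
def InLinGenPosIn (I Λ : Ideal (MvPolynomial (Fin (n+1)) K)) (t : ℕ) : Prop :=
  ∀ s : ℕ, s < t → ∀ J : Ideal (MvPolynomial (Fin (n+1)) K),
    IsLinearSubspace J s → Λ ≤ J → schemeDeg (interIdeal I J) ≤ s + 1

/-- `J` is the (saturated) homogeneous ideal of a rational normal curve of degree `t`
in `ℙ^n` : the curve is the image of `ℙ^1` under a parametrization by a basis-spanning
family of binary forms of degree `t`, and `J` is the vanishing ideal of (the affine cone
over) this image. -/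
def IsRNC (t : ℕ) (J : Ideal (MvPolynomial (Fin (n+1)) K)) : Prop :=
  ∃ p : Fin (n+1) → MvPolynomial (Fin 2) K,
    (∀ i, (p i).IsHomogeneous t) ∧
    Submodule.span K (Set.range p) = MvPolynomial.homogeneousSubmodule (Fin 2) K t ∧
    J = ⨅ x : Fin 2 → K,
      RingHom.ker (MvPolynomial.eval (fun i => MvPolynomial.eval x (p i)) :
        MvPolynomial (Fin (n+1)) K →+* K)

/-- `ρ(Γ)`: the maximal length of the intersection of `Γ` with a rational normal curve
(of degree `n`) in `ℙ^n`. -/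
def rhoInv (I : Ideal (MvPolynomial (Fin (n+1)) K)) : ℕ :=
  sSup {e : ℕ | ∃ J : Ideal (MvPolynomial (Fin (n+1)) K),
    IsRNC n J ∧ e = schemeDeg (interIdeal I J)}

/-- The (saturated homogeneous) vanishing ideal of a point of `ℙ^n`. -/
def pointIdeal (P : Projectivization K (Fin (n+1) → K)) : Ideal (MvPolynomial (Fin (n+1)) K) :=
  ⨅ c : K, RingHom.ker
    (MvPolynomial.eval (c • P.rep) : MvPolynomial (Fin (n+1)) K →+* K)

/-- The vanishing ideal of a finite set of points of `ℙ^n`. -/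
def idealOfFinset (S : Finset (Projectivization K (Fin (n+1) → K))) :
    Ideal (MvPolynomial (Fin (n+1)) K) :=
  ⨅ P ∈ S, pointIdeal P

/-- A finite set of points of `ℙ^n` is in uniform position if every subset `Y` has
Hilbert function `h_Y(ℓ) = min {|Y|, h_Γ(ℓ)}`. -/
def UniformPosition (S : Finset (Projectivization K (Fin (n+1) → K))) : Prop :=
  ∀ Y ⊆ S, ∀ ℓ : ℕ, hilbF (idealOfFinset Y) ℓ = min Y.card (hilbF (idealOfFinset S) ℓ)

end

section HilbertFunction

variable {K : Type} [Field K] {n : ℕ}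

/-- The degree `m` part of the ideal `I`. -/
noncomputable def gradedPart (I : Ideal (MvPolynomial (Fin (n+1)) K)) (m : ℕ) :
    Submodule K (MvPolynomial (Fin (n+1)) K) :=
  homogeneousSubmodule (Fin (n+1)) K m ⊓ I.restrictScalars K

lemma mem_gradedPart {I : Ideal (MvPolynomial (Fin (n+1)) K)} {m : ℕ}
    {x : MvPolynomial (Fin (n+1)) K} : x ∈ gradedPart I m ↔ x.IsHomogeneous m ∧ x ∈ I :=
  Iff.rfl

instance finiteDimensional_homogeneousSubmodule (m : ℕ) :
    FiniteDimensional K (homogeneousSubmodule (Fin (n+1)) K m) :=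
  Module.Finite.iff_fg.mpr (homogeneousSubmodule_fg _ _ m)

lemma gradedPart_le (I : Ideal (MvPolynomial (Fin (n+1)) K)) (m : ℕ) :
    gradedPart I m ≤ homogeneousSubmodule (Fin (n+1)) K m :=
  inf_le_left

instance finiteDimensional_gradedPart (I : Ideal (MvPolynomial (Fin (n+1)) K)) (m : ℕ) :
    FiniteDimensional K (gradedPart I m) :=
  Submodule.finiteDimensional_of_le (gradedPart_le I m)

lemma hilbF_add_finrank_gradedPart (I : Ideal (MvPolynomial (Fin (n+1)) K)) (m : ℕ) :
    hilbF I m + Module.finrank K (gradedPart I m) =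
      Module.finrank K (homogeneousSubmodule (Fin (n+1)) K m) := by
  have hrn := LinearMap.finrank_range_add_finrank_ker
    ((Ideal.Quotient.mkₐ K I).toLinearMap.domRestrict (homogeneousSubmodule (Fin (n+1)) K m))
  rw [LinearMap.range_domRestrict] at hrn
  have hker : gradedPart I m = (LinearMap.ker ((Ideal.Quotient.mkₐ K I).toLinearMap.domRestrict
      (homogeneousSubmodule (Fin (n+1)) K m))).map (Submodule.subtype _) := by
    ext x
    simp [mem_gradedPart, Ideal.Quotient.eq_zero_iff_mem, and_comm]
  rw [hker, Submodule.finrank_map_subtype_eq]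
  exact hrn

lemma hilbF_anti {I J : Ideal (MvPolynomial (Fin (n+1)) K)} {m : ℕ}
    (h : gradedPart I m ≤ gradedPart J m) : hilbF J m ≤ hilbF I m := by
  have h1 := hilbF_add_finrank_gradedPart I m
  have h2 := hilbF_add_finrank_gradedPart J m
  have h3 := Submodule.finrank_mono h
  omega

lemma mem_residualIdeal {I : Ideal (MvPolynomial (Fin (n+1)) K)}
    {f x : MvPolynomial (Fin (n+1)) K} : x ∈ residualIdeal I f ↔ x * f ∈ I :=
  Ideal.mem_colon_span_singleton


lemma finrank_map_mulRight {f : MvPolynomial (Fin (n+1)) K} (hf0 : f ≠ 0)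
    (W : Submodule K (MvPolynomial (Fin (n+1)) K)) :
    Module.finrank K (W.map (LinearMap.mulRight K f)) = Module.finrank K W :=
  (LinearEquiv.finrank_eq (Submodule.equivMapOfInjective _ (mul_left_injective₀ hf0) W)).symm

lemma map_mulRight_homogeneousSubmodule_le {f : MvPolynomial (Fin (n+1)) K} {k : ℕ}
    (hfh : f.IsHomogeneous k) (m : ℕ) :
    (homogeneousSubmodule (Fin (n+1)) K m).map (LinearMap.mulRight K f) ≤
      homogeneousSubmodule (Fin (n+1)) K (m + k) := by
  rintro _ ⟨x, hx, rfl⟩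
  exact IsHomogeneous.mul hx hfh

lemma gradedPart_inf_map_mulRight {f : MvPolynomial (Fin (n+1)) K} {k : ℕ}
    (hfh : f.IsHomogeneous k) (I : Ideal (MvPolynomial (Fin (n+1)) K)) (m : ℕ) :
    gradedPart I (m + k) ⊓ (homogeneousSubmodule (Fin (n+1)) K m).map (LinearMap.mulRight K f) =
      (gradedPart (residualIdeal I f) m).map (LinearMap.mulRight K f) := by
  ext y
  constructor
  · rintro ⟨hy, x, hx, rfl⟩
    exact ⟨x, ⟨hx, mem_residualIdeal.mpr hy.2⟩, rfl⟩
  · rintro ⟨x, hx, rfl⟩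
    exact ⟨⟨IsHomogeneous.mul hx.1 hfh, mem_residualIdeal.mp hx.2⟩, x, hx.1, rfl⟩

lemma finrank_gradedPart_sup_add {f : MvPolynomial (Fin (n+1)) K} {k : ℕ} (hf0 : f ≠ 0)
    (hfh : f.IsHomogeneous k) (I : Ideal (MvPolynomial (Fin (n+1)) K)) (m : ℕ) :
    Module.finrank K ↥(gradedPart I (m + k) ⊔
        (homogeneousSubmodule (Fin (n+1)) K m).map (LinearMap.mulRight K f)) +
      Module.finrank K (gradedPart (residualIdeal I f) m) =
    Module.finrank K (gradedPart I (m + k)) +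
      Module.finrank K (homogeneousSubmodule (Fin (n+1)) K m) := by
  have h := Submodule.finrank_sup_add_finrank_inf_eq (gradedPart I (m + k))
    ((homogeneousSubmodule (Fin (n+1)) K m).map (LinearMap.mulRight K f))
  rwa [gradedPart_inf_map_mulRight hfh, finrank_map_mulRight hf0, finrank_map_mulRight hf0] at h

lemma hilbF_residualIdeal_le {f : MvPolynomial (Fin (n+1)) K} {k : ℕ} (hf0 : f ≠ 0)
    (hfh : f.IsHomogeneous k) (I : Ideal (MvPolynomial (Fin (n+1)) K)) (m : ℕ) :
    hilbF (residualIdeal I f) m ≤ hilbF I (m + k) := by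
  have h := finrank_gradedPart_sup_add hf0 hfh I m
  have hle := Submodule.finrank_mono (sup_le (gradedPart_le I (m + k))
    (map_mulRight_homogeneousSubmodule_le hfh m))
  have h1 := hilbF_add_finrank_gradedPart I (m + k)
  have h2 := hilbF_add_finrank_gradedPart (residualIdeal I f) m
  omega

lemma gradedPart_sup_span_singleton {f : MvPolynomial (Fin (n+1)) K} {k : ℕ}
    (hfh : f.IsHomogeneous k) {I : Ideal (MvPolynomial (Fin (n+1)) K)}
    (hI : I.IsHomogeneous (homogeneousSubmodule (Fin (n+1)) K)) (m : ℕ) :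
    gradedPart (I ⊔ Ideal.span {f}) (m + k) = gradedPart I (m + k) ⊔
      (homogeneousSubmodule (Fin (n+1)) K m).map (LinearMap.mulRight K f) := by
  refine le_antisymm ?_ (sup_le (inf_le_inf_left _ fun x hx => ?_) ?_)
  · rintro y ⟨hy, hyI⟩
    obtain ⟨a, ha, b, hb, rfl⟩ := Submodule.mem_sup.mp hyI
    obtain ⟨c, rfl⟩ := Ideal.mem_span_singleton'.mp hb
    rw [SetLike.mem_coe, mem_homogeneousSubmodule] at hy
    rw [← homogeneousComponent_eq_self hy, map_add]
    refine Submodule.add_mem_sup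
      ⟨homogeneousComponent_mem _ _, homogeneousComponent_mem_of_mem hI ha _⟩
      ⟨homogeneousComponent m c, homogeneousComponent_mem _ _, ?_⟩
    rw [LinearMap.mulRight_apply]
    nth_rw 2 [← sum_homogeneousComponent c]
    rw [Finset.sum_mul, map_sum, Finset.sum_eq_single m]
    · exact (homogeneousComponent_eq_self ((homogeneousComponent_isHomogeneous m c).mul hfh)).symm
    · intro j _ hj
      rw [homogeneousComponent_of_mem ((homogeneousComponent_isHomogeneous j c).mul hfh), if_neg]
      omega
    · intro hm
      rw [homogeneousComponent_eq_zero m c (by simpa using hm), zero_mul, map_zero]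
  · exact Ideal.mem_sup_left hx
  · rintro _ ⟨x, hx, rfl⟩
    exact ⟨IsHomogeneous.mul hx hfh,
      Ideal.mem_sup_right (Ideal.mul_mem_left _ _ (Ideal.mem_span_singleton_self f))⟩

lemma hilbF_add_eq {f : MvPolynomial (Fin (n+1)) K} {k : ℕ} (hf0 : f ≠ 0)
    (hfh : f.IsHomogeneous k) {I : Ideal (MvPolynomial (Fin (n+1)) K)}
    (hI : I.IsHomogeneous (homogeneousSubmodule (Fin (n+1)) K)) (m : ℕ) :
    hilbF I (m + k) = hilbF (residualIdeal I f) m + hilbF (I ⊔ Ideal.span {f}) (m + k) := by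
  have h := finrank_gradedPart_sup_add hf0 hfh I m
  rw [← gradedPart_sup_span_singleton hfh hI] at h
  have h1 := hilbF_add_finrank_gradedPart I (m + k)
  have h2 := hilbF_add_finrank_gradedPart (residualIdeal I f) m
  have h3 := hilbF_add_finrank_gradedPart (I ⊔ Ideal.span {f}) (m + k)
  omega

end HilbertFunction

section Saturation

variable {K : Type} [Field K] {n : ℕ}

lemma colon_irrelevantIdeal_pow_mono (I : Ideal (MvPolynomial (Fin (n+1)) K)) :
    Monotone fun k : ℕ => Submodule.colon I
      ((irrelevantIdeal K n ^ k : Ideal (MvPolynomial (Fin (n+1)) K)) :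
        Set (MvPolynomial (Fin (n+1)) K)) :=
  fun _ _ h => Submodule.colon_mono le_rfl (Ideal.pow_le_pow_right h)

lemma colon_le_saturate (I : Ideal (MvPolynomial (Fin (n+1)) K)) (k : ℕ) :
    Submodule.colon I ((irrelevantIdeal K n ^ k : Ideal (MvPolynomial (Fin (n+1)) K)) :
        Set (MvPolynomial (Fin (n+1)) K)) ≤ saturate I :=
  le_iSup (fun k : ℕ => Submodule.colon I
    ((irrelevantIdeal K n ^ k : Ideal (MvPolynomial (Fin (n+1)) K)) :
        Set (MvPolynomial (Fin (n+1)) K))) k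

lemma le_saturate (I : Ideal (MvPolynomial (Fin (n+1)) K)) : I ≤ saturate I :=
  le_trans Ideal.le_colon (colon_le_saturate I 0)

lemma exists_saturate_eq_colon (I : Ideal (MvPolynomial (Fin (n+1)) K)) :
    ∃ k : ℕ, saturate I = Submodule.colon I
      ((irrelevantIdeal K n ^ k : Ideal (MvPolynomial (Fin (n+1)) K)) :
        Set (MvPolynomial (Fin (n+1)) K)) :=
  ⟨_, WellFoundedGT.iSup_eq_monotonicSequenceLimit ⟨_, colon_irrelevantIdeal_pow_mono I⟩⟩

lemma mem_irrelevantIdeal_pow {q : MvPolynomial (Fin (n+1)) K} {j : ℕ}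
    (hq : q.IsHomogeneous j) : q ∈ irrelevantIdeal K n ^ j := by
  refine (Ideal.mem_span_pow_iff_exists_isHomogeneous _ _).mpr ⟨map C q, hq.map C, ?_⟩
  rw [eval_map, eval₂_eta]

lemma homogeneousComponent_mul_mem {A : Ideal (MvPolynomial (Fin (n+1)) K)}
    (hA : A.IsHomogeneous (homogeneousSubmodule (Fin (n+1)) K)) {k m : ℕ}
    {t : MvPolynomial (Fin (n+1)) K}
    (ht : t ∈ Submodule.colon A ((irrelevantIdeal K n ^ k :
      Ideal (MvPolynomial (Fin (n+1)) K)) : Set (MvPolynomial (Fin (n+1)) K)))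
    (hm : k + t.totalDegree ≤ m) (r : MvPolynomial (Fin (n+1)) K) :
    homogeneousComponent m (r * t) ∈ A := by
  rw [← sum_homogeneousComponent r, Finset.sum_mul, map_sum]
  refine sum_mem fun j _ => ?_
  rcases le_or_gt k j with hj | hj
  · refine homogeneousComponent_mem_of_mem hA ?_ m
    rw [mul_comm]
    exact Submodule.mem_colon.mp ht _ (Ideal.pow_le_pow_right hj
      (mem_irrelevantIdeal_pow (homogeneousComponent_isHomogeneous j r)))
  · rw [homogeneousComponent_eq_zero]
    · exact A.zero_mem
    · have h1 := totalDegree_mul (homogeneousComponent j r) t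
      have h2 := (homogeneousComponent_isHomogeneous j r).totalDegree_le
      omega

/-- Saturating a homogeneous ideal does not change its Hilbert function in large degrees. -/
lemma eventually_hilbF_saturate {A : Ideal (MvPolynomial (Fin (n+1)) K)}
    (hA : A.IsHomogeneous (homogeneousSubmodule (Fin (n+1)) K)) :
    ∀ᶠ m in atTop, hilbF (saturate A) m = hilbF A m := by
  obtain ⟨k, hk⟩ := exists_saturate_eq_colon A
  obtain ⟨T, hT⟩ := IsNoetherian.noetherian (saturate A)
  filter_upwards [eventually_ge_atTop (k + T.sup totalDegree)] with m hm
  refine le_antisymm (hilbF_anti (inf_le_inf_left _ fun x hx => le_saturate A hx)) (hilbF_anti ?_)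
  rintro x ⟨hx, hxS⟩
  refine ⟨hx, ?_⟩
  rw [SetLike.mem_coe, mem_homogeneousSubmodule] at hx
  have hxT : x ∈ Submodule.span _ (T : Set (MvPolynomial (Fin (n+1)) K)) := hT ▸ hxS
  obtain ⟨r, -, hr⟩ := Submodule.mem_span_finset.mp hxT
  show x ∈ A
  rw [← homogeneousComponent_eq_self hx, ← hr, map_sum]
  refine sum_mem fun t htT => homogeneousComponent_mul_mem hA (k := k) ?_ ?_ _
  · rw [← hk, ← hT]
    exact Submodule.subset_span htT
  · have := Finset.le_sup (f := totalDegree) htT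
    omega

/-- A saturated ideal over an infinite field has a linear form that is regular on the quotient. -/
lemma exists_linear_regular [Infinite K] {I : Ideal (MvPolynomial (Fin (n+1)) K)}
    (hI : saturate I = I) : ∃ l : MvPolynomial (Fin (n+1)) K, l.IsHomogeneous 1 ∧
      ∀ x, x * l ∈ I → x ∈ I := by
  set R := MvPolynomial (Fin (n+1)) K
  have hfin := associatedPrimes.finite R (R ⧸ I)
  have := hfin.to_subtype
  have hne : ¬ ∀ l : homogeneousSubmodule (Fin (n+1)) K 1,
      ∃ P : associatedPrimes R (R ⧸ I), (l : R) ∈ P.1 := by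
    intro hcov
    obtain ⟨⟨P, hP⟩, hPtop⟩ := Subspace.exists_eq_top_of_iUnion_eq_univ
      (p := fun P : associatedPrimes R (R ⧸ I) =>
        (P.1.restrictScalars K).comap (homogeneousSubmodule (Fin (n+1)) K 1).subtype)
      (Set.eq_univ_of_forall fun l => Set.mem_iUnion.mpr (hcov l))
    obtain ⟨hprime, y, rfl⟩ := isAssociatedPrime_iff.mp hP
    obtain ⟨x, rfl⟩ := Ideal.Quotient.mk_surjective y
    have hmul : ∀ r : R, r ∈ Submodule.colon (⊥ : Submodule R (R ⧸ I))
        {Ideal.Quotient.mk I x} ↔ r * x ∈ I := by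
      intro r
      rw [Submodule.mem_colon_singleton, Submodule.mem_bot, ← Ideal.Quotient.eq_zero_iff_mem,
        map_mul]
      rfl
    have hirr : irrelevantIdeal K n ≤ Submodule.colon ⊥ {Ideal.Quotient.mk I x} := by
      refine Ideal.span_le.mpr ?_
      rintro _ ⟨i, rfl⟩
      have : (⟨X i, isHomogeneous_X K i⟩ : homogeneousSubmodule (Fin (n+1)) K 1) ∈
        (⊤ : Submodule K (homogeneousSubmodule (Fin (n+1)) K 1)) := trivial
      rw [← hPtop] at this
      exact this
    have hx : x ∈ I := by
      rw [← hI]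
      refine colon_le_saturate I 1 (Submodule.mem_colon.mpr fun s hs => ?_)
      rw [pow_one] at hs
      rw [smul_eq_mul, mul_comm]
      exact (hmul s).mp (hirr hs)
    exact hprime.ne_top ((Ideal.eq_top_iff_one _).mpr ((hmul 1).mpr (by rwa [one_mul])))
  push Not at hne
  obtain ⟨l, hl⟩ := hne
  refine ⟨l, l.2, fun x hx => ?_⟩
  have hreg : (l : R) ∉ ⋃ p ∈ associatedPrimes R (R ⧸ I), (p : Set R) := by
    simpa using hl
  rw [biUnion_associatedPrimes_eq_zero_divisors] at hreg
  by_contra hxI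
  refine hreg ⟨Ideal.Quotient.mk I x, fun h => hxI (Ideal.Quotient.eq_zero_iff_mem.mp h), ?_⟩
  rw [← Ideal.Quotient.eq_zero_iff_mem, mul_comm, map_mul] at hx
  exact hx

end Saturation

section Regularity

variable {K : Type} [Field K] {n : ℕ}

lemma monotone_hilbF {I : Ideal (MvPolynomial (Fin (n+1)) K)} {l : MvPolynomial (Fin (n+1)) K}
    (hl0 : l ≠ 0) (hlh : l.IsHomogeneous 1) (hreg : ∀ x, x * l ∈ I → x ∈ I) :
    Monotone (hilbF I) := by
  have hres : residualIdeal I l = I := le_antisymm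
    (fun x hx => hreg x (mem_residualIdeal.mp hx))
    fun x hx => mem_residualIdeal.mpr (I.mul_mem_right l hx)
  refine monotone_nat_of_le_succ fun m => ?_
  simpa [hres] using hilbF_residualIdeal_le hl0 hlh I m

lemma schemeDeg_eq {I : Ideal (MvPolynomial (Fin (n+1)) K)} {d : ℕ}
    (hd : ∀ᶠ m in atTop, hilbF I m = d) : schemeDeg I = d := by
  have h : ∃ d : ℕ, ∀ᶠ m : ℕ in atTop, hilbF I m = d := ⟨d, hd⟩
  rw [schemeDeg, dif_pos h]
  obtain ⟨m, h1, h2⟩ := (h.choose_spec.and hd).exists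
  exact h1.symm.trans h2

lemma schemeReg_spec {I : Ideal (MvPolynomial (Fin (n+1)) K)} {d : ℕ}
    (hd : ∀ᶠ m in atTop, hilbF I m = d) :
    1 ≤ schemeReg I ∧ ∀ m : ℕ, schemeReg I - 1 ≤ m → hilbF I m = d := by
  obtain ⟨N, hN⟩ := eventually_atTop.mp hd
  have h := Nat.sInf_mem (s := {p : ℕ | 1 ≤ p ∧ ∀ m : ℕ, p - 1 ≤ m → hilbF I m = schemeDeg I})
    ⟨N + 1, by omega, fun m hm => by rw [schemeDeg_eq hd]; exact hN m (by omega)⟩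
  rw [schemeDeg_eq hd] at h
  rwa [schemeReg, schemeDeg_eq hd]

lemma schemeReg_le {I : Ideal (MvPolynomial (Fin (n+1)) K)} {p : ℕ} (hp : 1 ≤ p)
    (h : ∀ m : ℕ, p - 1 ≤ m → hilbF I m = schemeDeg I) : schemeReg I ≤ p :=
  Nat.sInf_le ⟨hp, h⟩

lemma exists_eventually_eq_of_monotone {u : ℕ → ℕ} (hu : Monotone u) {b : ℕ}
    (hb : ∀ m, u m ≤ b) : ∃ d, ∀ᶠ m in atTop, u m = d := by
  have hbdd : BddAbove (Set.range u) := ⟨b, by rintro _ ⟨m, rfl⟩; exact hb m⟩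
  obtain ⟨N, hN⟩ := Nat.sSup_mem (Set.range_nonempty u) hbdd
  refine ⟨u N, eventually_atTop.mpr ⟨N, fun m hm => le_antisymm ?_ (hu hm)⟩⟩
  rw [hN]
  exact le_csSup hbdd ⟨m, rfl⟩

end Regularity

/-- Remark 2.3, the Horace-method estimate. -/
theorem stmt6 (K : Type) [Field K] [IsAlgClosed K] [CharZero K] (n k : ℕ)
    (I : Ideal (MvPolynomial (Fin (n+1)) K))
    (hfin : IsFiniteSubscheme I)
    (f : MvPolynomial (Fin (n+1)) K) (hf0 : f ≠ 0) (hfh : f.IsHomogeneous k)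
    (h : schemeReg (interIdeal I (Ideal.span {f})) < schemeReg I) :
    (schemeReg I : ℤ) - k ≤ (schemeReg (residualIdeal I f) : ℤ) := by
  obtain ⟨d, hdpos, hd⟩ := hfin.finite
  obtain ⟨l, hlh, hlreg⟩ := exists_linear_regular hfin.saturated
  have hl0 : l ≠ 0 := by
    rintro rfl
    have htop : ∀ x, x ∈ I := fun x => hlreg x (by simp)
    obtain ⟨m, hm⟩ := hd.exists
    have h1 := hilbF_add_finrank_gradedPart I m
    rw [show gradedPart I m = homogeneousSubmodule (Fin (n+1)) K m from
      inf_eq_left.mpr fun x _ => htop x] at h1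
    omega
  have hImono := monotone_hilbF hl0 hlh hlreg
  have hIle : ∀ m, hilbF I m ≤ d := fun m => by
    obtain ⟨m', hm', hmm'⟩ := (hd.and (eventually_ge_atTop m)).exists
    exact hm' ▸ hImono hmm'
  have hJmono : Monotone (hilbF (residualIdeal I f)) := monotone_hilbF hl0 hlh fun x hx =>
    mem_residualIdeal.mpr (hlreg _ (by
      rw [mul_right_comm]
      exact mem_residualIdeal.mp hx))
  obtain ⟨e, he⟩ := exists_eventually_eq_of_monotone hJmono
    fun m => (hilbF_residualIdeal_le hf0 hfh I m).trans (hIle _)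
  have hA : (I ⊔ Ideal.span {f}).IsHomogeneous (homogeneousSubmodule (Fin (n+1)) K) :=
    hfin.homog.sup (Ideal.homogeneous_span _ _ (by
      rintro _ rfl
      exact ⟨k, hfh⟩))
  have hS : ∀ᶠ m in atTop, hilbF (interIdeal I (Ideal.span {f})) m = d - e := by
    filter_upwards [eventually_hilbF_saturate hA, hd, (tendsto_sub_atTop_nat k).eventually he,
      eventually_ge_atTop k] with m h1 h2 h3 h4
    have h5 := hilbF_add_eq hf0 hfh hfin.homog (m - k)
    rw [Nat.sub_add_cancel h4] at h5
    rw [interIdeal, h1]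
    omega
  by_contra hlt
  obtain ⟨hJ1, hJ⟩ := schemeReg_spec he
  obtain ⟨hS1, hS⟩ := schemeReg_spec hS
  have hle : schemeReg I ≤ schemeReg I - 1 := by
    refine schemeReg_le (by omega) fun m hm => ?_
    rw [schemeDeg_eq hd]
    refine le_antisymm (hIle m) ?_
    have h1 := hilbF_add_eq hf0 hfh hfin.homog (m - k)
    rw [Nat.sub_add_cancel (by omega), hJ _ (by omega)] at h1
    have h2 : hilbF (interIdeal I (Ideal.span {f})) m ≤ hilbF (I ⊔ Ideal.span {f}) m :=
      hilbF_anti (inf_le_inf_left _ fun x hx => le_saturate _ hx)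
    rw [hS m (by omega)] at h2
    omega
  omega
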